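/- arXiv:0804.2190 — 3 statements merged into one kernel-verified Lean document; each statement's English description precedes it below -/
import Mathlib

section
/- Let (ℤ, b, 𝒟) be a number system with b ≤ −3 and |d'| ≤ |b| for all d' ∈ 𝒟. Fix d ∈ 𝒟 and an integer u ≠ 0 with |u| ≤ |b| − 1; if 0 ∉ 𝒟, assume |u| ≤ |b| − 2. Let ℬ be the set of digits of 𝒟 that occur as a component of a minimal-length expansion of 0, of u + 1, of u, or of u − 1. If d ∉ ℬ, then for every integer k ≥ 1 the pre-number system (ℤ, b, (𝒟 \ {d}) ∪ {d − u·b^k}) is a number system. -/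
def IsExpansion (b : ℤ) (D : Finset ℤ) (a : ℤ) (ℓ : ℕ) (f : ℕ → ℤ) : Prop :=
  1 ≤ ℓ ∧ (∀ i < ℓ, f i ∈ D) ∧ a = ∑ i ∈ Finset.range ℓ, f i * b ^ i

def IsNumberSystem (b : ℤ) (D : Finset ℤ) : Prop :=
  ∀ a : ℤ, ∃ ℓ : ℕ, ∃ f : ℕ → ℤ, IsExpansion b D a ℓ f

/-- An expansion of `a` of minimal length among all expansions of `a`. -/
def IsMinimalExpansion (b : ℤ) (D : Finset ℤ) (a : ℤ) (ℓ : ℕ) (f : ℕ → ℤ) : Prop :=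
  IsExpansion b D a ℓ f ∧ ∀ ℓ' : ℕ, ∀ f' : ℕ → ℤ, IsExpansion b D a ℓ' f' → ℓ ≤ ℓ'

/-- The set of "bad" digits: those occurring in a minimal-length expansion of
`0`, `u + 1`, `u`, or `u - 1`. -/
def badSet (b : ℤ) (D : Finset ℤ) (u : ℤ) : Set ℤ :=
  {x : ℤ | ∃ a ∈ ({0, u + 1, u, u - 1} : Set ℤ), ∃ ℓ : ℕ, ∃ f : ℕ → ℤ,
    IsMinimalExpansion b D a ℓ f ∧ ∃ i < ℓ, f i = x}

/-- `DigitSum b S m a` says that `a` is the value in base `b` of a string of `m` digits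
from `S`; the empty string is allowed. -/
inductive DigitSum (b : ℤ) (S : Finset ℤ) : ℕ → ℤ → Prop
  | nil : DigitSum b S 0 0
  | cons {m : ℕ} {a c : ℤ} (hc : c ∈ S) (ha : DigitSum b S m a) : DigitSum b S (m + 1) (c + b * a)

namespace DigitSum

variable {b : ℤ} {S : Finset ℤ}

theorem eq_zero {a : ℤ} (h : DigitSum b S 0 a) : a = 0 := by
  cases h; rfl

theorem exists_cons {m : ℕ} {a : ℤ} (h : DigitSum b S (m + 1) a) :
    ∃ c ∈ S, ∃ a', DigitSum b S m a' ∧ a = c + b * a' := by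
  cases h with
  | cons hc ha => exact ⟨_, hc, _, ha, rfl⟩

theorem snoc {m : ℕ} {a c : ℤ} (ha : DigitSum b S m a) (hc : c ∈ S) :
    DigitSum b S (m + 1) (a + c * b ^ m) := by
  induction ha with
  | nil => simpa using cons hc (nil (b := b))
  | cons hc' _ ih =>
    have h := cons hc' ih
    convert h using 1
    ring

theorem mono {T : Finset ℤ} (hST : S ⊆ T) {m : ℕ} {a : ℤ} (h : DigitSum b S m a) :
    DigitSum b T m a := by
  induction h with
  | nil => exact nil
  | cons hc _ ih => exact cons (hST hc) ih

theorem zero (h : (0 : ℤ) ∈ S) (m : ℕ) : DigitSum b S m 0 := by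
  induction m with
  | zero => exact nil
  | succ m ih => simpa using cons h ih

theorem of_sum (f : ℕ → ℤ) (ℓ : ℕ) (hf : ∀ i < ℓ, f i ∈ S) :
    DigitSum b S ℓ (∑ i ∈ Finset.range ℓ, f i * b ^ i) := by
  induction ℓ with
  | zero => exact nil
  | succ ℓ ih =>
    rw [Finset.sum_range_succ]
    exact (ih fun i hi => hf i (by omega)).snoc (hf ℓ (by omega))

theorem exists_sum {m : ℕ} {a : ℤ} (h : DigitSum b S m a) :
    ∃ f : ℕ → ℤ, (∀ i < m, f i ∈ S) ∧ a = ∑ i ∈ Finset.range m, f i * b ^ i := by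
  induction h with
  | nil => exact ⟨fun _ => 0, by simp, by simp⟩
  | @cons m a c hc _ ih =>
    obtain ⟨f, hf, rfl⟩ := ih
    refine ⟨fun i => Nat.casesOn i c f, ?_, ?_⟩
    · rintro (_ | i) hi
      · exact hc
      · exact hf i (by omega)
    · rw [Finset.sum_range_succ', Finset.mul_sum, add_comm]
      congr 1
      · exact Finset.sum_congr rfl fun i _ => by ring
      · simp

end DigitSum

theorem DigitSum.exists_isExpansion {b : ℤ} {S : Finset ℤ} {m : ℕ} {a : ℤ}
    (h : DigitSum b S (m + 1) a) : ∃ ℓ f, IsExpansion b S a ℓ f := by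
  obtain ⟨f, hf, ha⟩ := h.exists_sum
  exact ⟨m + 1, f, by omega, hf, ha⟩

theorem IsExpansion.digitSum {b : ℤ} {S : Finset ℤ} {ℓ : ℕ} {a : ℤ} {f : ℕ → ℤ}
    (h : IsExpansion b S a ℓ f) : ∃ m, DigitSum b S (m + 1) a := by
  obtain ⟨hℓ, hf, rfl⟩ := h
  obtain ⟨m, rfl⟩ : ∃ m, ℓ = m + 1 := ⟨ℓ - 1, by omega⟩
  exact ⟨m, .of_sum f _ hf⟩

theorem IsNumberSystem.exists_isMinimalExpansion {b : ℤ} {D : Finset ℤ}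
    (h : IsNumberSystem b D) (a : ℤ) : ∃ ℓ f, IsMinimalExpansion b D a ℓ f := by
  classical
  have ha := h a
  obtain ⟨f, hf⟩ := Nat.find_spec ha
  exact ⟨_, f, hf, fun ℓ' f' h' => Nat.find_min' ha ⟨f', h'⟩⟩

theorem exists_digitSum_erase {b : ℤ} {D : Finset ℤ} (hns : IsNumberSystem b D)
    {d u : ℤ} (hbad : d ∉ badSet b D u) {a : ℤ} (ha : a ∈ ({0, u + 1, u, u - 1} : Set ℤ)) :
    ∃ m, DigitSum b (D.erase d) (m + 1) a := by
  obtain ⟨ℓ, f, hf⟩ := hns.exists_isMinimalExpansion a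
  obtain ⟨hℓ, hfD, hsum⟩ := hf.1
  refine IsExpansion.digitSum (f := f) (ℓ := ℓ) ⟨hℓ, fun i hi => ?_, hsum⟩
  exact Finset.mem_erase.2 ⟨fun h => hbad ⟨a, ha, ℓ, f, hf, i, hi, h⟩, hfD i hi⟩

theorem eq_of_dvd_sub_of_complete {b : ℤ} {D : Finset ℤ} (hcard : D.card = b.natAbs)
    (hcover : ∀ a : ℤ, ∃ d ∈ D, b ∣ a - d) {x y : ℤ} (hx : x ∈ D) (hy : y ∈ D)
    (hxy : b ∣ x - y) : x = y := by
  classical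
  have hinj : Set.InjOn (fun z : ℤ => z % b) D := by
    apply Finset.injOn_of_card_image_eq
    refine le_antisymm Finset.card_image_le ?_
    have hsub : Finset.Ico 0 |b| ⊆ D.image fun z => z % b := by
      intro r hr
      obtain ⟨h0, h1⟩ := Finset.mem_Ico.1 hr
      obtain ⟨c, hc, hdvd⟩ := hcover r
      refine Finset.mem_image.2 ⟨c, hc, ?_⟩
      have h : c % b = r % b := ((Int.modEq_iff_dvd).2 hdvd)
      change c % b = r
      rw [h, ← Int.emod_abs, Int.emod_eq_of_lt h0 h1]
    have := Finset.card_le_card hsub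
    rw [Int.card_Ico, sub_zero, Int.abs_eq_natAbs, Int.toNat_natCast] at this
    omega
  exact hinj hx hy ((Int.modEq_iff_dvd).2 hxy).symm

theorem abs_quotient_le_one {b : ℤ} {D : Finset ℤ} (hb : b ≤ -3) (hsize : ∀ c ∈ D, |c| ≤ |b|)
    (hzero : ∀ c ∈ D, b ∣ c → (0 : ℤ) ∈ D → c = 0)
    {u : ℤ} (hu : |u| ≤ |b| - 1) (hu' : (0 : ℤ) ∉ D → |u| ≤ |b| - 2)
    {x v c y : ℤ} (hx : |x| ≤ 1) (hv : v = 0 ∨ v = u) (hu0 : u ≠ 0) (hc : c ∈ D)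
    (h : x + v = c + b * y) : |y| ≤ 1 := by
  have hcb := hsize c hc
  have hz := hzero c hc
  rw [abs_of_nonpos (by omega : b ≤ 0)] at *
  rw [abs_le] at hx hcb hu ⊢
  have hy2 : |y| ≤ 2 := by
    rw [abs_le]
    constructor
    · by_contra hlt
      have : b * y ≥ b * (-3) := by nlinarith
      rcases hv with rfl | rfl <;> omega
    · by_contra hlt
      have : b * y ≤ b * 3 := by nlinarith
      rcases hv with rfl | rfl <;> omega
  rw [abs_le] at hy2
  have hdvd : c = b ∨ c = -b → -(-b - 2) ≤ u ∧ u ≤ -b - 2 := by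
    intro hcb'
    rw [← abs_le]
    apply hu'
    intro h0
    have := hz (by rcases hcb' with rfl | rfl <;> simp) h0
    omega
  obtain ⟨hy₁, hy₂⟩ := hy2
  interval_cases y <;> rcases hv with rfl | rfl <;> omega

/-- The quantity `|3 * x + sign u|` decreases as long as `x` is outside `[-1, 1]`. -/
theorem abs_quotient_lt {b : ℤ} (hb : b ≤ -3) {u : ℤ} (hu : |u| ≤ |b| - 1)
    {x v c y : ℤ} (hx : ¬ |x| ≤ 1) (hv : v = 0 ∨ v = u) (hu0 : u ≠ 0) (hc : |c| ≤ |b|)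
    (h : x + v = c + b * y) : |3 * y + u.sign| < |3 * x + u.sign| := by
  rw [abs_of_nonpos (by omega : b ≤ 0)] at hu hc
  have hv' : |v| ≤ -b - 1 := by
    rcases hv with rfl | rfl
    · simp only [abs_zero]; omega
    · exact hu
  rw [abs_le] at hu hc hv'
  have hbig : 3 ≤ |x| → |y| < |x| := by
    intro h3
    have hx1 := le_abs_self x
    have hx2 := neg_abs_le x
    rw [abs_lt]
    constructor
    · by_contra hlt
      nlinarith [mul_nonneg (by omega : 0 ≤ -b - 1) (by omega : 0 ≤ |x| - 3),
        mul_nonneg (by omega : 0 ≤ -b) (by omega : 0 ≤ -|x| - y)]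
    · by_contra hlt
      nlinarith [mul_nonneg (by omega : 0 ≤ -b - 1) (by omega : 0 ≤ |x| - 3),
        mul_nonneg (by omega : 0 ≤ -b) (by omega : 0 ≤ y - |x|)]
  by_cases h3 : 3 ≤ |x|
  · have := hbig h3
    simp only [Int.abs_eq_natAbs] at *
    rcases lt_or_gt_of_ne hu0 with hneg | hpos
    · rw [Int.sign_eq_neg_one_of_neg hneg]; omega
    · rw [Int.sign_eq_one_of_pos hpos]; omega
  · have hx2 : x = 2 ∨ x = -2 := by
      simp only [Int.abs_eq_natAbs] at *
      omega
    have hx3 : -2 ≤ x ∧ x ≤ 2 := by omega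
    have hy1 : -3 < y := by
      by_contra hlt
      nlinarith [mul_nonneg (by omega : 0 ≤ -b) (by omega : 0 ≤ -3 - y)]
    have hy2 : y < 3 := by
      by_contra hlt
      nlinarith [mul_nonneg (by omega : 0 ≤ -b) (by omega : 0 ≤ y - 3)]
    simp only [Int.abs_eq_natAbs]
    rcases lt_or_gt_of_ne hu0 with hneg | hpos
    · rw [Int.sign_eq_neg_one_of_neg hneg]
      interval_cases y <;> rcases hv with rfl | rfl <;> rcases hx2 with rfl | rfl <;> omega
    · rw [Int.sign_eq_one_of_pos hpos]
      interval_cases y <;> rcases hv with rfl | rfl <;> rcases hx2 with rfl | rfl <;> omega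

section Replace

variable {b : ℤ} {D : Finset ℤ} {d u : ℤ}

theorem mem_neighbors_of_abs_le_one {x : ℤ} (hx : |x| ≤ 1) :
    x + u ∈ ({0, u + 1, u, u - 1} : Set ℤ) := by
  rw [abs_le] at hx
  have : x = -1 ∨ x = 0 ∨ x = 1 := by omega
  rcases this with rfl | rfl | rfl <;> simp [add_comm, sub_eq_add_neg]

theorem exists_digitSum_of_add_erase {D' : Finset ℤ} (hD' : D.erase d ⊆ D')
    (hstep : ∀ x v c y : ℤ, |x| ≤ 1 → v = 0 ∨ v = u → c ∈ D → x + v = c + b * y → |y| ≤ 1)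
    (hzero : ∃ m, DigitSum b (D.erase d) (m + 1) 0)
    {x e q : ℤ} (hx : |x| ≤ 1) (he : e = 0 ∨ e = u)
    (hxe : ∃ n, DigitSum b (D.erase d) (n + 1) (x + e))
    (ih : ∀ y : ℤ, |y| ≤ 1 → (∃ n, DigitSum b (D.erase d) (n + 1) y) →
      ∃ n, DigitSum b D' (n + 1) (y + q)) :
    ∃ n, DigitSum b D' (n + 1) (x + (e + b * q)) := by
  obtain ⟨n, hn⟩ := hxe
  obtain ⟨c, hc, y, hy, hxy⟩ := hn.exists_cons
  have hyg : ∃ n, DigitSum b (D.erase d) (n + 1) y := by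
    cases n with
    | zero => rwa [hy.eq_zero]
    | succ n => exact ⟨n, hy⟩
  obtain ⟨n', hn'⟩ := ih y (hstep x e c y hx he (Finset.mem_of_mem_erase hc) hxy) hyg
  refine ⟨n' + 1, ?_⟩
  have := DigitSum.cons (hD' hc) hn'
  convert this using 1
  rw [← add_assoc, hxy]
  ring

/-- No further occurrence of `d` arises while the pending carries `p` are absorbed. -/
theorem exists_digitSum_add_of_erase {D' : Finset ℤ} (hD' : D.erase d ⊆ D')
    (hstep : ∀ x v c y : ℤ, |x| ≤ 1 → v = 0 ∨ v = u → c ∈ D → x + v = c + b * y → |y| ≤ 1)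
    (hgood : ∀ a ∈ ({0, u + 1, u, u - 1} : Set ℤ), ∃ m, DigitSum b (D.erase d) (m + 1) a)
    {m : ℕ} {p : ℤ} (hp : DigitSum b {0, u} m p) :
    ∀ x : ℤ, |x| ≤ 1 → (∃ n, DigitSum b (D.erase d) (n + 1) x) →
      ∃ n, DigitSum b D' (n + 1) (x + p) := by
  induction hp with
  | nil =>
    rintro x - ⟨n, hn⟩
    exact ⟨n, by simpa using hn.mono hD'⟩
  | @cons m q e he hq ih =>
    intro x hx hxg
    have he' : e = 0 ∨ e = u := by simpa using he
    refine exists_digitSum_of_add_erase hD' hstep (hgood 0 (by simp)) hx he' ?_ ih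
    rcases he' with rfl | rfl
    · simpa using hxg
    · exact hgood _ (mem_neighbors_of_abs_le_one hx)

/-- Reading off one digit `c` of `x + e`, a digit `d` being traded for a carry `u`. -/
theorem exists_digitSum_carry {k : ℕ} {q x e c y : ℤ} (hq : DigitSum b {0, u} k q) (hc : c ∈ D)
    (hxy : x + e = c + b * y)
    (ih : ∀ p, DigitSum b {0, u} (k + 1) p →
      ∃ n, DigitSum b (insert (d - u * b ^ (k + 1)) (D.erase d)) (n + 1) (y + p)) :
    ∃ n, DigitSum b (insert (d - u * b ^ (k + 1)) (D.erase d)) (n + 1) (x + (e + b * q)) := by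
  by_cases hcd : c = d
  · obtain ⟨n, hn⟩ := ih _ (hq.snoc (c := u) (by simp))
    refine ⟨n + 1, ?_⟩
    have := DigitSum.cons (Finset.mem_insert_self (d - u * b ^ (k + 1)) (D.erase d)) hn
    convert this using 1
    rw [← add_assoc, hxy, hcd]
    ring
  · obtain ⟨n, hn⟩ := ih _ (hq.snoc (c := 0) (by simp))
    refine ⟨n + 1, ?_⟩
    have := DigitSum.cons (Finset.mem_insert_of_mem (Finset.mem_erase.2 ⟨hcd, hc⟩)) hn
    convert this using 1
    rw [← add_assoc, hxy]
    ring

theorem exists_digitSum_add_of_abs_le_one {k : ℕ}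
    (hstep : ∀ x v c y : ℤ, |x| ≤ 1 → v = 0 ∨ v = u → c ∈ D → x + v = c + b * y → |y| ≤ 1)
    (hgood : ∀ a ∈ ({0, u + 1, u, u - 1} : Set ℤ), ∃ m, DigitSum b (D.erase d) (m + 1) a)
    {n : ℕ} {x : ℤ} (hxn : DigitSum b D n x) :
    |x| ≤ 1 → ∀ p, DigitSum b {0, u} (k + 1) p →
      ∃ n, DigitSum b (insert (d - u * b ^ (k + 1)) (D.erase d)) (n + 1) (x + p) := by
  have hsub := Finset.subset_insert (d - u * b ^ (k + 1)) (D.erase d)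
  induction hxn with
  | nil =>
    intro hx p hp
    exact exists_digitSum_add_of_erase hsub hstep hgood hp 0 hx (hgood 0 (by simp))
  | @cons n y c hc _ ih =>
    intro hx p hp
    obtain ⟨e, he, q, hq, rfl⟩ := hp.exists_cons
    have he' : e = 0 ∨ e = u := by simpa using he
    rcases he' with rfl | rfl
    · exact exists_digitSum_carry hq hc (add_zero _)
        (ih (hstep _ 0 c y hx (Or.inl rfl) hc (add_zero _)))
    · exact exists_digitSum_of_add_erase hsub hstep (hgood 0 (by simp)) hx (Or.inr rfl)
        (hgood _ (mem_neighbors_of_abs_le_one hx))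
        (exists_digitSum_add_of_erase hsub hstep hgood hq)

end Replace

theorem replace_digit_negative_base
    (b : ℤ) (D : Finset ℤ) (hb : b ≤ -3)
    (hcard : D.card = b.natAbs)
    (hcover : ∀ a : ℤ, ∃ d' ∈ D, b ∣ a - d')
    (hns : IsNumberSystem b D)
    (hsize : ∀ d' ∈ D, |d'| ≤ |b|)
    (d : ℤ) (hd : d ∈ D)
    (u : ℤ) (hu0 : u ≠ 0) (hu : |u| ≤ |b| - 1)
    (hu' : (0 : ℤ) ∉ D → |u| ≤ |b| - 2)
    (hbad : d ∉ badSet b D u) :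
    ∀ k : ℕ, 1 ≤ k → IsNumberSystem b (insert (d - u * b ^ k) (D.erase d)) := by
  intro k hk a
  obtain ⟨k, rfl⟩ : ∃ j, k = j + 1 := ⟨k - 1, by omega⟩
  have hstep : ∀ x v c y : ℤ, |x| ≤ 1 → v = 0 ∨ v = u → c ∈ D → x + v = c + b * y → |y| ≤ 1 := by
    intro x v c y hx hv hc h
    refine abs_quotient_le_one hb hsize (fun c hc hbc h0 => ?_) hu hu' hx hv hu0 hc h
    exact eq_of_dvd_sub_of_complete hcard hcover hc h0 (by simpa using hbc)
  have hgood : ∀ a ∈ ({0, u + 1, u, u - 1} : Set ℤ), ∃ m, DigitSum b (D.erase d) (m + 1) a :=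
    fun a ha => exists_digitSum_erase hns hbad ha
  have key : ∀ N : ℕ, ∀ x : ℤ, (|3 * x + u.sign|).toNat = N →
      ∀ p, DigitSum b {0, u} (k + 1) p →
      ∃ n, DigitSum b (insert (d - u * b ^ (k + 1)) (D.erase d)) (n + 1) (x + p) := by
    intro N
    induction N using Nat.strong_induction_on with
    | _ N ih =>
      intro x hN p hp
      by_cases hx : |x| ≤ 1
      · obtain ⟨ℓ, f, hf⟩ := hns x
        obtain ⟨n, hn⟩ := hf.digitSum
        exact exists_digitSum_add_of_abs_le_one hstep hgood hn hx p hp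
      · obtain ⟨e, he, q, hq, rfl⟩ := hp.exists_cons
        obtain ⟨c, hc, y, hy⟩ := hcover (x + e)
        have hxy : x + e = c + b * y := by linarith
        have hlt := abs_quotient_lt hb hu hx (by simpa using he) hu0 (hsize c hc) hxy
        have hnonneg := abs_nonneg (3 * y + u.sign)
        exact exists_digitSum_carry hq hc hxy (ih _ (by omega) y rfl)
  obtain ⟨n, hn⟩ := key _ a rfl 0 (DigitSum.zero (by simp) _)
  rw [add_zero] at hn
  exact hn.exists_isExpansion
end

section
/- Let b ∈ ℤ with b ≥ 4. Then for every integer k ≥ 1, both (ℤ, b, {0, 1, …, b − 2} ∪ {−1 − b^k}) and (ℤ, b, {−1, 2, 3, …, b − 2, b} ∪ {1 + b^k}) are number systems. In particular, for each base b ≥ 4 there exist infinitely many valid digit sets containing 0 and infinitely many valid digit sets not containing 0. -/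
theorem IsExpansion.cons {b : ℤ} {D : Finset ℤ} {a d : ℤ} {ℓ : ℕ} {f : ℕ → ℤ} (hd : d ∈ D)
    (h : IsExpansion b D a ℓ f) :
    IsExpansion b D (d + b * a) (ℓ + 1) (fun i => Nat.casesOn i d f) := by
  obtain ⟨-, hf, rfl⟩ := h
  refine ⟨by omega, ?_, ?_⟩
  · rintro (_ | i) hi
    · exact hd
    · exact hf i (by omega)
  · rw [Finset.sum_range_succ', Finset.mul_sum, add_comm]
    simp only [pow_zero, mul_one, pow_succ]
    congr 1
    exact Finset.sum_congr rfl fun i _ => by ring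

theorem isExpansion_digit {b : ℤ} {D : Finset ℤ} {d : ℤ} (hd : d ∈ D) :
    IsExpansion b D d 1 (fun _ => d) :=
  ⟨le_rfl, fun _ _ => hd, by simp⟩

/-- `HasBinaryDigits b n v` says that `v` is written in base `b` with `n` digits from `{0, 1}`. -/
def HasBinaryDigits (b : ℤ) : ℕ → ℤ → Prop
  | 0, v => v = 0
  | n + 1, v => ∃ w, HasBinaryDigits b n w ∧ (v = b * w ∨ v = b * w + 1)

namespace HasBinaryDigits

theorem succ {b : ℤ} {n : ℕ} {v : ℤ} (h : HasBinaryDigits b n v) :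
    HasBinaryDigits b (n + 1) v := by
  induction n generalizing v with
  | zero => exact ⟨0, rfl, .inl (by rw [show v = 0 from h, mul_zero])⟩
  | succ n ih =>
    obtain ⟨w, hw, hv⟩ := h
    exact ⟨w, ih hw, hv⟩

theorem add_pow {b : ℤ} {n : ℕ} {v : ℤ} (h : HasBinaryDigits b n v) :
    HasBinaryDigits b (n + 1) (v + b ^ n) := by
  induction n generalizing v with
  | zero =>
    obtain rfl : v = 0 := h
    exact ⟨0, rfl, .inr (by simp)⟩
  | succ n ih =>
    obtain ⟨w, hw, rfl | rfl⟩ := h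
    · exact ⟨w + b ^ n, ih hw, .inl (by ring)⟩
    · exact ⟨w + b ^ n, ih hw, .inr (by ring)⟩

end HasBinaryDigits

section Induction

variable {b : ℤ} {P : ℤ → Prop}

theorem HasBinaryDigits.induction_add (hb : 4 ≤ b) (h0 : P 0) (h1 : P 1)
    (hone : ∀ q, P q → P (b * q + 1))
    (hsmall : ∀ q r, 0 ≤ r → r ≤ b - 2 → P q → P (q + 1) → P (b * q + r))
    {n : ℕ} {v : ℤ} (h : HasBinaryDigits b n v) : P v ∧ P (v + 1) := by
  induction n generalizing v with
  | zero =>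
    obtain rfl : v = 0 := h
    exact ⟨h0, by simpa using h1⟩
  | succ n ih =>
    obtain ⟨w, hw, hv⟩ := h
    obtain ⟨hw0, hw1⟩ := ih hw
    rcases hv with rfl | rfl
    · exact ⟨by simpa using hsmall w 0 le_rfl (by omega) hw0 hw1, hone w hw0⟩
    · exact ⟨hone w hw0, by
        simpa [add_assoc] using hsmall w 2 (by omega) (by omega) hw0 hw1⟩

theorem HasBinaryDigits.induction_add_two (hb : 4 ≤ b) {k : ℕ} (h0 : P 0) (h1 : P 1)
    (hone : ∀ q, P q → P (b * q + 1))
    (hsmall : ∀ q r, 0 ≤ r → r ≤ b - 2 → P q → P (q + 1) → P (b * q + r))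
    (hlast : ∀ q, P (q + 1 + b ^ k) → P (b * q + (b - 1)))
    {v : ℤ} (h : HasBinaryDigits b (k + 1) v) : P (v + 2) := by
  obtain ⟨w, hw, hv⟩ := h
  obtain ⟨hw0, hw1⟩ := hw.induction_add hb h0 h1 hone hsmall
  rcases hv with rfl | rfl
  · exact hsmall w 2 (by omega) (by omega) hw0 hw1
  · rw [show b * w + 1 + 2 = b * w + 3 by ring]
    rcases hb.eq_or_lt with rfl | hb'
    · refine hlast w ?_
      rw [add_right_comm]
      exact (hw.add_pow.induction_add hb h0 h1 hone hsmall).2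
    · exact hsmall w 3 (by omega) (by omega) hw0 hw1

theorem induction_of_le_pow_add_one (hb : 4 ≤ b) {k : ℕ} (h0 : P 0) (h1 : P 1)
    (hone : ∀ q, P q → P (b * q + 1))
    (hsmall : ∀ q r, 0 ≤ r → r ≤ b - 2 → P q → P (q + 1) → P (b * q + r))
    (hlast : ∀ q, P (q + 1 + b ^ k) → P (b * q + (b - 1)))
    {j m : ℕ} (hjm : j + m = k + 1) {u v : ℤ} (hu0 : 0 ≤ u) (hu : u ≤ b ^ j + 1)
    (hv : HasBinaryDigits b m v) : P (u + b ^ j * v) := by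
  induction j generalizing m u v with
  | zero =>
    obtain rfl : m = k + 1 := by omega
    rw [pow_zero] at hu ⊢
    rw [one_mul, add_comm]
    obtain ⟨hv0, hv1⟩ := hv.induction_add hb h0 h1 hone hsmall
    obtain rfl | rfl | rfl : u = 0 ∨ u = 1 ∨ u = 2 := by omega
    · simpa using hv0
    · exact hv1
    · exact hv.induction_add_two hb h0 h1 hone hsmall hlast
  | succ j ih =>
    have hdiv := Int.mul_ediv_add_emod u b
    have hr0 := Int.emod_nonneg u (show b ≠ 0 by omega)
    have hrb := Int.emod_lt_of_pos u (show 0 < b by omega)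
    set q := u / b
    set r := u % b
    have hq0 : 0 ≤ q := Int.ediv_nonneg hu0 (by omega)
    have hqj : q ≤ b ^ j := by
      rw [pow_succ] at hu
      by_contra! h
      nlinarith
    have hsum : u + b ^ (j + 1) * v = b * (q + b ^ j * v) + r := by
      rw [← hdiv]; ring
    have hP (x : ℤ) (hx0 : 0 ≤ x) (hx : x ≤ b ^ j + 1) : P (x + b ^ j * v) :=
      ih (by omega) hx0 hx hv.succ
    rw [hsum]
    by_cases hr : r = b - 1
    · rw [hr]
      refine hlast _ ?_
      have hk : k = j + m := by omega
      rw [show q + b ^ j * v + 1 + b ^ k = (q + 1) + b ^ j * (v + b ^ m) by rw [hk]; ring]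
      exact ih (by omega) (by omega) (by omega) hv.add_pow
    · refine hsmall _ r hr0 (by omega) (hP q hq0 (by omega)) ?_
      rw [add_right_comm]
      exact hP (q + 1) (by omega) (by omega)

/-- The hypotheses describe one step of the digit algorithm: `n = b * q + r` is followed by
`q` or `q + 1`, except that `r = b - 1` leads to `q + 1 + b ^ k`. -/
theorem digit_step_induction (hb : 4 ≤ b) {k : ℕ} (h0 : P 0) (h1 : P 1)
    (hone : ∀ q, P q → P (b * q + 1))
    (hsmall : ∀ q r, 0 ≤ r → r ≤ b - 2 → P q → P (q + 1) → P (b * q + r))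
    (hlast : ∀ q, P (q + 1 + b ^ k) → P (b * q + (b - 1))) (n : ℤ) : P n := by
  have hpow : 1 ≤ b ^ k := one_le_pow₀ (by omega)
  have hsucc : b ^ (k + 1) = b * b ^ k := pow_succ' b k
  have hmul : 4 * b ^ k ≤ b * b ^ k := by nlinarith
  have base (x : ℤ) (hx0 : 0 ≤ x) (hx : x ≤ b ^ (k + 1)) : P x := by
    simpa using induction_of_le_pow_add_one hb h0 h1 hone hsmall hlast (j := k + 1) (m := 0)
      rfl hx0 (hx.trans (by omega)) (v := 0) rfl
  induction hN : n.natAbs using Nat.strong_induction_on generalizing n with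
  | _ N ih =>
    by_cases hn : 0 ≤ n ∧ n ≤ b ^ (k + 1)
    · exact base n hn.1 hn.2
    have hdiv := Int.mul_ediv_add_emod n b
    have hr0 := Int.emod_nonneg n (show b ≠ 0 by omega)
    have hrb := Int.emod_lt_of_pos n (show 0 < b by omega)
    set q := n / b
    set r := n % b
    have step (x : ℤ) (hx : x.natAbs < n.natAbs) : P x := ih _ (hN ▸ hx) x rfl
    rcases lt_or_ge n 0 with hneg | hnonneg
    · have hq : q < 0 := by by_contra! h; nlinarith
      have hqn : n ≤ q := by nlinarith
      rw [← hdiv]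
      by_cases hr : r = b - 1
      · rw [hr]
        refine hlast q ?_
        by_cases hx : 0 ≤ q + 1 + b ^ k
        · exact base _ hx (by omega)
        · exact step _ (by omega)
      · have hne : q ≠ n := by
          rintro h
          rw [h] at hdiv
          nlinarith [mul_nonneg (show 0 ≤ -n - 1 by omega) (show 0 ≤ b - 1 by omega),
            show r ≤ b - 2 by omega]
        exact hsmall q r hr0 (by omega) (step _ (by omega)) (step _ (by omega))
    · have hq : 0 ≤ q := Int.ediv_nonneg hnonneg (by omega)
      have hlarge : b * b ^ k < n := by omega
      have hqn : q + 1 + b ^ k < n := by nlinarith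
      rw [← hdiv]
      by_cases hr : r = b - 1
      · rw [hr]
        exact hlast q (step _ (by omega))
      · exact hsmall q r hr0 (by omega) (step _ (by omega)) (step _ (by omega))

end Induction

theorem isNumberSystem_insert_neg_one_sub_pow {b : ℤ} (hb : 4 ≤ b) (k : ℕ) :
    IsNumberSystem b (insert (-1 - b ^ (k + 1)) (Finset.Icc 0 (b - 2))) := by
  set D : Finset ℤ := insert (-1 - b ^ (k + 1)) (Finset.Icc 0 (b - 2)) with hD
  have hdigit (r : ℤ) (h0 : 0 ≤ r) (h : r ≤ b - 2) : r ∈ D := by simp [hD, h0, h]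
  have hspecial : -1 - b ^ (k + 1) ∈ D := by simp [hD]
  have hsmall (q r : ℤ) (h0 : 0 ≤ r) (h : r ≤ b - 2) (hq : ∃ ℓ f, IsExpansion b D q ℓ f) :
      ∃ ℓ f, IsExpansion b D (b * q + r) ℓ f := by
    obtain ⟨ℓ, f, hf⟩ := hq
    exact ⟨_, _, add_comm r (b * q) ▸ hf.cons (hdigit r h0 h)⟩
  intro a
  refine digit_step_induction (P := fun a => ∃ ℓ f, IsExpansion b D a ℓ f) hb (k := k)
    ⟨_, _, isExpansion_digit (hdigit 0 le_rfl (by omega))⟩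
    ⟨_, _, isExpansion_digit (hdigit 1 (by omega) (by omega))⟩
    (fun q => hsmall q 1 (by omega) (by omega)) (fun q r h0 h hq _ => hsmall q r h0 h hq) ?_ a
  rintro q ⟨ℓ, f, hf⟩
  rw [show b * q + (b - 1) = (-1 - b ^ (k + 1)) + b * (q + 1 + b ^ k) by ring]
  exact ⟨_, _, hf.cons hspecial⟩

theorem isNumberSystem_insert_one_add_pow {b : ℤ} (hb : 4 ≤ b) (k : ℕ) :
    IsNumberSystem b
      (insert (1 + b ^ (k + 1)) (insert (-1) (insert b (Finset.Icc 2 (b - 2))))) := by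
  set D : Finset ℤ :=
    insert (1 + b ^ (k + 1)) (insert (-1) (insert b (Finset.Icc 2 (b - 2)))) with hD
  have hneg : -1 ∈ D := by simp [hD]
  have hspecial : 1 + b ^ (k + 1) ∈ D := by simp [hD]
  have hbase : b ∈ D := by simp [hD]
  have hzero : ∃ ℓ f, IsExpansion b D (-0) ℓ f := by
    rw [show (-0 : ℤ) = b + b * (-1) by ring]
    exact ⟨_, _, (isExpansion_digit hneg).cons hbase⟩
  have hone (q : ℤ) (hq : ∃ ℓ f, IsExpansion b D (-q) ℓ f) :
      ∃ ℓ f, IsExpansion b D (-(b * q + 1)) ℓ f := by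
    obtain ⟨ℓ, f, hf⟩ := hq
    rw [show -(b * q + 1) = -1 + b * -q by ring]
    exact ⟨_, _, hf.cons hneg⟩
  intro a
  rw [← neg_neg a]
  refine digit_step_induction (P := fun a => ∃ ℓ f, IsExpansion b D (-a) ℓ f) hb (k := k)
    hzero ⟨_, _, isExpansion_digit hneg⟩ hone ?_ ?_ (-a)
  · rintro q r hr0 hr hq ⟨ℓ, f, hf⟩
    by_cases hr1 : r = 1
    · subst hr1
      exact hone q hq
    rw [show -(b * q + r) = (b - r) + b * -(q + 1) by ring]
    refine ⟨_, _, hf.cons ?_⟩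
    simp only [hD, Finset.mem_insert, Finset.mem_Icc]
    omega
  · rintro q ⟨ℓ, f, hf⟩
    rw [show -(b * q + (b - 1)) = (1 + b ^ (k + 1)) + b * -(q + 1 + b ^ k) by ring]
    exact ⟨_, _, hf.cons hspecial⟩

theorem infinitely_many_digit_sets_positive_base
    (b : ℤ) (hb : 4 ≤ b) :
    (∀ k : ℕ, 1 ≤ k →
      IsNumberSystem b (insert (-1 - b ^ k) (Finset.Icc 0 (b - 2))) ∧
      IsNumberSystem b
        (insert (1 + b ^ k) (insert (-1) (insert b (Finset.Icc 2 (b - 2)))))) ∧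
    {D : Finset ℤ | D.card = b.natAbs ∧ (0 : ℤ) ∈ D ∧ IsNumberSystem b D}.Infinite ∧
    {D : Finset ℤ | D.card = b.natAbs ∧ (0 : ℤ) ∉ D ∧ IsNumberSystem b D}.Infinite := by
  have hpow (k : ℕ) : b ≤ b ^ (k + 1) := le_self_pow₀ (by omega) (by omega)
  have hinj {k l : ℕ} (h : b ^ (k + 1) = b ^ (l + 1)) : k = l := by
    have := Int.pow_right_injective (a := b) (by omega) h
    omega
  refine ⟨fun k hk => ?_, ?_, ?_⟩
  · obtain ⟨k, rfl⟩ := Nat.exists_eq_add_of_le' hk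
    exact ⟨isNumberSystem_insert_neg_one_sub_pow hb k, isNumberSystem_insert_one_add_pow hb k⟩
  · refine Set.infinite_of_injective_forall_mem
      (f := fun k : ℕ => insert (-1 - b ^ (k + 1)) (Finset.Icc 0 (b - 2))) ?_ fun k => ⟨?_, ?_,
        isNumberSystem_insert_neg_one_sub_pow hb k⟩
    · intro k l h
      have hmem : -1 - b ^ (k + 1) ∈ insert (-1 - b ^ (l + 1)) (Finset.Icc 0 (b - 2)) :=
        (show insert _ _ = insert _ _ from h) ▸ Finset.mem_insert_self _ _
      rw [Finset.mem_insert, Finset.mem_Icc] at hmem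
      have := hpow k
      exact hinj (by omega)
    · have := hpow k
      rw [Finset.card_insert_of_notMem (by rw [Finset.mem_Icc]; omega), Int.card_Icc]
      omega
    · rw [Finset.mem_insert, Finset.mem_Icc]
      omega
  · refine Set.infinite_of_injective_forall_mem
      (f := fun k : ℕ =>
        insert (1 + b ^ (k + 1)) (insert (-1) (insert b (Finset.Icc 2 (b - 2))))) ?_
      fun k => ⟨?_, ?_, isNumberSystem_insert_one_add_pow hb k⟩
    · intro k l h
      have hmem : 1 + b ^ (k + 1) ∈
          insert (1 + b ^ (l + 1)) (insert (-1) (insert b (Finset.Icc 2 (b - 2)))) :=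
        (show insert _ _ = insert _ _ from h) ▸ Finset.mem_insert_self _ _
      simp only [Finset.mem_insert, Finset.mem_Icc] at hmem
      have := hpow k
      exact hinj (by omega)
    · have := hpow k
      rw [Finset.card_insert_of_notMem
          (by simp only [Finset.mem_insert, Finset.mem_Icc]; omega),
        Finset.card_insert_of_notMem
          (by simp only [Finset.mem_insert, Finset.mem_Icc]; omega),
        Finset.card_insert_of_notMem (by rw [Finset.mem_Icc]; omega), Int.card_Icc]
      omega
    · have := hpow k
      simp only [Finset.mem_insert, Finset.mem_Icc]
      omega
end

section
/- Let (ℤ, −2, {d_0, d_1}) be a pre-number system (so exactly one of d_0, d_1 is even) with dynamic mapping T and attractor 𝒜. Then 𝒜 consists of exactly one cycle under T — i.e., for all a, a' ∈ 𝒜 there exists n ≥ 0 with T^n(a) = a' — if and only if either |d_0 − d_1| = 1, or there exists an integer i ≥ 1 with |d_0 − d_1| = 3^i and 3 ∤ d_0 and 3 ∤ d_1. -/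
/-- The attractor of the dynamic mapping `T`: the set of `T`-periodic points. -/
def attractor (T : ℤ → ℤ) : Set ℤ :=
  {a : ℤ | ∃ n : ℕ, 1 ≤ n ∧ T^[n] a = a}

/-- In the coordinate `6a - s`, the map `T` is `y ↦ (-y ± 3D) / 2`. -/
def HalvesNeg (T : ℤ → ℤ) (s D : ℤ) : Prop :=
  ∀ a : ℤ, 2 * (6 * T a - s) = -(6 * a - s) + 3 * D ∨ 2 * (6 * T a - s) = -(6 * a - s) - 3 * D

namespace HalvesNeg

variable {T : ℤ → ℤ} {s D : ℤ}

theorem two_mul_abs_le (h : HalvesNeg T s D) (a : ℤ) :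
    2 * |6 * T a - s| ≤ |6 * a - s| + 3 * |D| := by
  rcases h a with h | h <;>
  · rcases abs_cases (6 * T a - s) with h1 | h1 <;> rcases abs_cases (6 * a - s) with h2 | h2 <;>
      rcases abs_cases D with h3 | h3 <;> omega

theorem abs_iterate_le (h : HalvesNeg T s D) {a M : ℤ} (hD : 3 * |D| ≤ M)
    (ha : |6 * a - s| ≤ M) (n : ℕ) : |6 * T^[n] a - s| ≤ M := by
  induction n with
  | zero => exact ha
  | succ n ih =>
    rw [Function.iterate_succ_apply']
    have := h.two_mul_abs_le (T^[n] a)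
    omega

theorem abs_le_of_mem_attractor (h : HalvesNeg T s D) {a : ℤ} (ha : a ∈ attractor T) :
    |6 * a - s| ≤ 3 * |D| := by
  obtain ⟨n, hn, hna⟩ := ha
  by_contra! hlt
  have h1 := h.two_mul_abs_le a
  obtain ⟨n, rfl⟩ := Nat.exists_eq_add_of_le' hn
  have h2 := h.abs_iterate_le (a := T a) (M := |6 * a - s| - 1) (by omega) (by omega) n
  rw [← Function.iterate_succ_apply, hna] at h2
  omega

theorem exists_iterate_mem_attractor (h : HalvesNeg T s D) (a : ℤ) :
    ∃ n, T^[n] a ∈ attractor T := by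
  have hmem : ∀ n, T^[n] a ∈ Set.Icc (-(|6 * a - s| + 3 * |D| + |s|))
      (|6 * a - s| + 3 * |D| + |s|) := by
    intro n
    have h1 := abs_le.mp (h.abs_iterate_le (a := a) (M := |6 * a - s| + 3 * |D|)
      (by linarith [abs_nonneg (6 * a - s)]) (by linarith [abs_nonneg D]) n)
    have h2 := le_abs_self s
    have h3 := neg_abs_le s
    have h4 := abs_nonneg s
    constructor <;> omega
  obtain ⟨m, n, hmn, heq⟩ :=
    (Set.finite_Icc (-(|6 * a - s| + 3 * |D| + |s|))
      (|6 * a - s| + 3 * |D| + |s|)).exists_lt_map_eq_of_forall_mem hmem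
  refine ⟨m, n - m, by omega, ?_⟩
  rw [← Function.iterate_add_apply, Nat.sub_add_cancel hmn.le, heq]

theorem dvd_pow_mul_iterate_sub (h : HalvesNeg T s D) (a : ℤ) (n : ℕ) :
    3 * D ∣ (-2) ^ n * (6 * T^[n] a - s) - (6 * a - s) := by
  induction n with
  | zero => simp
  | succ n ih =>
    rw [Function.iterate_succ_apply']
    obtain ⟨k, hk⟩ := ih
    rcases h (T^[n] a) with h | h
    · refine ⟨k - (-2) ^ n, ?_⟩
      rw [pow_succ]
      linear_combination hk - (-2) ^ n * h
    · refine ⟨k + (-2) ^ n, ?_⟩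
      rw [pow_succ]
      linear_combination hk - (-2) ^ n * h

theorem dvd_iterate_iff (h : HalvesNeg T s D) {m : ℤ} (hm : IsCoprime m (-2)) (hmD : m ∣ 3 * D)
    (a : ℤ) (n : ℕ) : m ∣ 6 * T^[n] a - s ↔ m ∣ 6 * a - s := by
  rw [← (dvd_iff_dvd_of_dvd_sub (hmD.trans (h.dvd_pow_mul_iterate_sub a n)))]
  exact ⟨fun hd ↦ hd.mul_left _, hm.pow_right.dvd_of_dvd_mul_left⟩

theorem dvd_of_dvd (h : HalvesNeg T s D)
    (hone : ∀ a ∈ attractor T, ∀ a' ∈ attractor T, ∃ n : ℕ, T^[n] a = a')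
    {m : ℤ} (hm : IsCoprime m (-2)) (hmD : m ∣ 3 * D) {a : ℤ} (ha : m ∣ 6 * a - s) (b : ℤ) :
    m ∣ 6 * b - s := by
  obtain ⟨k, hk⟩ := h.exists_iterate_mem_attractor a
  obtain ⟨l, hl⟩ := h.exists_iterate_mem_attractor b
  obtain ⟨n, hn⟩ := hone _ hk _ hl
  rwa [← h.dvd_iterate_iff hm hmD b l, ← hn, h.dvd_iterate_iff hm hmD, h.dvd_iterate_iff hm hmD]

/-- Periodic points congruent modulo `D` agree, or are the two points of a `2`-cycle. -/
theorem exists_iterate_eq_of_dvd_sub (h : HalvesNeg T s D) (hs : Odd s) (hD : Odd D) {a b : ℤ}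
    (ha : a ∈ attractor T) (hb : b ∈ attractor T) (hab : D ∣ a - b) : ∃ n, T^[n] a = b := by
  have h1 := abs_le.mp (h.abs_le_of_mem_attractor ha)
  have h2 := abs_le.mp (h.abs_le_of_mem_attractor hb)
  obtain ⟨k, hk⟩ := hab
  obtain ⟨t, rfl⟩ := hs
  have hD0 : 0 < |D| := abs_pos.mpr (by rintro rfl; simp at hD)
  have hle : |D| * |k| ≤ |D| * 1 := by
    rw [← abs_mul, ← hk, mul_one]
    exact abs_le.mpr ⟨by omega, by omega⟩
  have hk1 := abs_le.mp (le_of_mul_le_mul_left hle hD0)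
  have hTa := h a
  obtain rfl | rfl | rfl : k = -1 ∨ k = 0 ∨ k = 1 := by omega
  · refine ⟨1, ?_⟩
    rw [Function.iterate_one]
    rcases abs_cases D with h3 | h3 <;> omega
  · exact ⟨0, by simp; omega⟩
  · refine ⟨1, ?_⟩
    rw [Function.iterate_one]
    rcases abs_cases D with h3 | h3 <;> omega

end HalvesNeg

theorem exists_neg_two_pow_three_pow_eq (i : ℕ) :
    ∃ u : ℤ, (-2 : ℤ) ^ 3 ^ i = 1 + 3 ^ (i + 1) * u ∧ ¬ 3 ∣ u := by
  induction i with
  | zero => exact ⟨-1, by norm_num, by norm_num⟩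
  | succ i ih =>
    obtain ⟨u, hu, hu3⟩ := ih
    refine ⟨u + 3 * (3 ^ i * u ^ 2 + 3 ^ i * 3 ^ i * u ^ 3), ?_, ?_⟩
    · rw [pow_succ 3 i, pow_mul, hu]
      ring
    · rwa [dvd_add_left (dvd_mul_right _ _)]

/-- Powers of `-2` act transitively on each class modulo `3` of units modulo `3 ^ (i + 1)`. -/
theorem exists_three_pow_dvd_neg_two_pow_mul_sub {x y : ℤ} (hx : ¬ 3 ∣ x) (hxy : 3 ∣ y - x)
    (i : ℕ) : ∃ n : ℕ, (3 : ℤ) ^ (i + 1) ∣ (-2) ^ n * y - x := by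
  induction i with
  | zero => exact ⟨0, by simpa using hxy⟩
  | succ i ih =>
    obtain ⟨n, k, hk⟩ := ih
    obtain ⟨u, hu, hu3⟩ := exists_neg_two_pow_three_pow_eq i
    have hux : ¬ (3 : ℤ) ∣ u * x := fun hd ↦ (Int.prime_three.dvd_or_dvd hd).elim hu3 hx
    obtain ⟨j, c, hj⟩ : ∃ j : ℕ, (3 : ℤ) ∣ k + j * (u * x) := by
      generalize u * x = v at hux
      have hv : v % 3 = 1 ∨ v % 3 = 2 := by omega
      have hk3 : k % 3 = 0 ∨ k % 3 = 1 ∨ k % 3 = 2 := by omega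
      rcases hv with hv | hv <;> rcases hk3 with hk3 | hk3 | hk3
      exacts [⟨0, by omega⟩, ⟨2, by omega⟩, ⟨1, by omega⟩, ⟨0, by omega⟩, ⟨1, by omega⟩,
        ⟨2, by omega⟩]
    obtain ⟨e, he⟩ : (3 ^ (i + 1) * u) ^ 2 ∣
        (1 + 3 ^ (i + 1) * u) ^ j - 1 - j * (3 ^ (i + 1) * u) := by
      generalize 3 ^ (i + 1) * u = w
      clear hj
      induction j with
      | zero => simp
      | succ j ih =>
        obtain ⟨q, hq⟩ := ih
        refine ⟨q * (1 + w) + j, ?_⟩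
        push_cast
        linear_combination (1 + w) * hq
    refine ⟨n + 3 ^ i * j, ?_⟩
    rw [pow_add (-2 : ℤ) n, pow_mul, hu]
    refine ⟨c + k * j * u * 3 ^ i + e * 3 ^ i * u ^ 2 * (x + 3 ^ (i + 1) * k), ?_⟩
    linear_combination (1 + 3 ^ (i + 1) * u) ^ j * hk + (x + 3 ^ (i + 1) * k) * he +
      3 ^ (i + 1) * hj

/-- For base `-2` with digits `{d₀, d₁}`, the attractor consists of exactly one
cycle iff `|d₀ − d₁| = 1`, or `|d₀ − d₁| = 3^i` with `i ≥ 1` and neither digit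
is divisible by `3`. -/
theorem base_neg_two_one_cycle_iff
    (d₀ d₁ : ℤ)
    (hpar : (Even d₀ ∧ Odd d₁) ∨ (Odd d₀ ∧ Even d₁))
    (dig : ℤ → ℤ)
    (hdig : ∀ a : ℤ, dig a ∈ ({d₀, d₁} : Set ℤ) ∧ (-2 : ℤ) ∣ a - dig a)
    (T : ℤ → ℤ) (hT : ∀ a : ℤ, (-2 : ℤ) * T a = a - dig a) :
    (∀ a ∈ attractor T, ∀ a' ∈ attractor T, ∃ n : ℕ, T^[n] a = a') ↔
      (|d₀ - d₁| = 1 ∨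
        ((∃ i : ℕ, 1 ≤ i ∧ |d₀ - d₁| = 3 ^ i) ∧ ¬ (3 ∣ d₀) ∧ ¬ (3 ∣ d₁))) := by
  have hodd : Odd (d₀ + d₁) ∧ Odd (d₀ - d₁) := by
    rcases hpar with ⟨h0, h1⟩ | ⟨h0, h1⟩
    · exact ⟨h0.add_odd h1, h0.sub_odd h1⟩
    · exact ⟨h0.add_even h1, h0.sub_even h1⟩
  obtain ⟨hs, hD⟩ := hodd
  have h : HalvesNeg T (d₀ + d₁) (d₀ - d₁) := by
    intro a
    have h1 := hT a
    rcases (hdig a).1 with h2 | h2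
    · left; rw [h2] at h1; omega
    · right; rw [Set.mem_singleton_iff.mp h2] at h1; omega
  constructor
  · intro hone
    rw [or_iff_not_imp_left]
    intro hD1
    have hprime : ∀ {p : ℕ}, p.Prime → p ∣ (d₀ - d₁).natAbs → p = 3 := by
      intro p hp hpD
      by_contra hp3
      have hpD' : (p : ℤ) ∣ d₀ - d₁ := Int.natCast_dvd.mpr hpD
      have hp2 : p ≠ 2 := by
        rintro rfl
        obtain ⟨t, ht⟩ := hD
        omega
      have hc2 : Nat.Coprime p 2 := (Nat.coprime_primes hp Nat.prime_two).mpr hp2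
      have hc3 : Nat.Coprime p 3 := (Nat.coprime_primes hp Nat.prime_three).mpr hp3
      have hc6 : IsCoprime (p : ℤ) 6 := Nat.isCoprime_iff_coprime.mpr (hc2.mul_right hc3)
      have hcm : IsCoprime (p : ℤ) (-2) :=
        (Nat.isCoprime_iff_coprime.mpr hc2 : IsCoprime (p : ℤ) (2 : ℕ)).neg_right
      obtain ⟨u, v, huv⟩ := hc6
      have ha : (p : ℤ) ∣ 6 * (v * (d₀ + d₁)) - (d₀ + d₁) :=
        ⟨-(u * (d₀ + d₁)), by linear_combination (d₀ + d₁) * huv⟩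
      have hb := h.dvd_of_dvd hone hcm (hpD'.mul_left 3) ha (v * (d₀ + d₁) + v)
      have h1 : (p : ℤ) ∣ 1 := by
        have h2 := (dvd_sub hb ha).add (dvd_mul_left (p : ℤ) u)
        have h3 : 6 * (v * (d₀ + d₁) + v) - (d₀ + d₁) - (6 * (v * (d₀ + d₁)) - (d₀ + d₁)) + u * p
          = 1 := by linear_combination huv
        rwa [h3] at h2
      exact hp.one_lt.ne' (by exact_mod_cast Int.eq_one_of_dvd_one (by positivity) h1)
    have hpow := Nat.eq_prime_pow_of_unique_prime_dvd
      (by obtain ⟨t, ht⟩ := hD; omega : (d₀ - d₁).natAbs ≠ 0) hprime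
    generalize (d₀ - d₁).natAbs.primeFactorsList.length = i at hpow
    have habs : |d₀ - d₁| = 3 ^ i := by
      rw [Int.abs_eq_natAbs, hpow]
      norm_cast
    have hi : 1 ≤ i := by
      by_contra! hi0
      obtain rfl : i = 0 := by omega
      exact hD1 (by simpa using habs)
    have h3D : 3 ∣ d₀ - d₁ := by
      rw [← dvd_abs, habs]
      exact dvd_pow_self 3 (by omega)
    have hmain : ¬ 3 ∣ d₀ := by
      rintro ⟨t, ht⟩
      obtain ⟨r, hr⟩ := h3D
      have hb := h.dvd_of_dvd hone (m := 9) (by norm_num) (by omega)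
        (a := -(2 * t - r)) (by omega) (-(2 * t - r) + 1)
      omega
    exact ⟨⟨i, hi, habs⟩, hmain, fun h1 ↦ hmain (by omega)⟩
  · intro hcond a ha b hb
    obtain ⟨n, hn⟩ : ∃ n : ℕ, 3 * (d₀ - d₁) ∣
        (-2) ^ n * (6 * b - (d₀ + d₁)) - (6 * a - (d₀ + d₁)) := by
      rcases hcond with h1 | ⟨⟨i, hi, habs⟩, h0, h1⟩
      · refine ⟨0, ?_⟩
        rw [← abs_dvd, abs_mul, h1, abs_of_pos three_pos, pow_zero]
        omega
      · have h3D : 3 ∣ d₀ - d₁ := by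
          rw [← dvd_abs, habs]
          exact dvd_pow_self 3 (by omega)
        obtain ⟨n, hn⟩ := exists_three_pow_dvd_neg_two_pow_mul_sub
          (x := 6 * a - (d₀ + d₁)) (y := 6 * b - (d₀ + d₁)) (by omega) (by omega) i
        refine ⟨n, ?_⟩
        rwa [← abs_dvd, abs_mul, habs, abs_of_pos three_pos, ← pow_succ']
    have hcop : IsCoprime (d₀ - d₁) (-2) := by
      obtain ⟨t, ht⟩ := hD
      exact ⟨1, t, by omega⟩
    have hmem : T^[n] a ∈ attractor T := by
      obtain ⟨m, hm, hma⟩ := ha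
      exact ⟨m, hm, by rw [← Function.iterate_add_apply, add_comm, Function.iterate_add_apply, hma]⟩
    have hdvd : d₀ - d₁ ∣ T^[n] a - b := by
      have h1 := dvd_sub (h.dvd_pow_mul_iterate_sub a n) hn
      have h2 : (-2) ^ n * (6 * T^[n] a - (d₀ + d₁)) - (6 * a - (d₀ + d₁)) -
          ((-2) ^ n * (6 * b - (d₀ + d₁)) - (6 * a - (d₀ + d₁))) =
          3 * ((-2) ^ (n + 1) * (b - T^[n] a)) := by ring
      rw [h2, mul_dvd_mul_iff_left three_ne_zero] at h1
      exact (dvd_sub_comm).mp (hcop.pow_right.dvd_of_dvd_mul_left h1)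
    obtain ⟨m, hm⟩ := h.exists_iterate_eq_of_dvd_sub hs hD hmem hb hdvd
    exact ⟨m + n, by rw [Function.iterate_add_apply, hm]⟩
end
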